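/- arXiv:1410.7145 — 3 statements merged into one kernel-verified Lean document; each statement's English description precedes it below -/
import Mathlib

section
/- For every d ≥ 2 and n ≥ 2, the d^n vectors Φ_n^d(s_1,…,s_{n−2},k,l), for s_1,…,s_{n−2},k,l ∈ {0,…,d−1}, form an orthonormal basis of (ℂ^d)^{⊗n}: ⟨Φ_n^d(s'_1,…,s'_{n−2},k',l') , Φ_n^d(s_1,…,s_{n−2},k,l)⟩ = δ_{s'_1 s_1} ⋯ δ_{s'_{n−2} s_{n−2}} δ_{k'k} δ_{l'l}. -/
open Matrix

/-- The primitive `d`-th root of unity `ω = e^{2πi/d}`. -/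
noncomputable def omega (d : ℕ) : ℂ := Complex.exp (2 * Real.pi * Complex.I / d)

/-- The Weyl operator `W_{k,l} = ∑_s ω^{(s−l)k} |s−l⟩⟨s|` on `ℂ^d`
(basis indices taken mod `d`, realized as `ZMod d`). -/
noncomputable def Weyl (d : ℕ) (k l : ZMod d) : Matrix (ZMod d) (ZMod d) ℂ :=
  Matrix.of fun i j => if i = j - l then omega d ^ ((j - l) * k).val else 0

/-- Application of `𝟙^{⊗(m)} ⊗ M` on the last tensor factor of `(ℂ^d)^{⊗(m+1)}`,
in coordinates (vectors of `(ℂ^d)^{⊗(m+1)}` are functions `(Fin (m+1) → ZMod d) → ℂ`). -/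
noncomputable def applyLast (d m : ℕ) [NeZero d] (M : Matrix (ZMod d) (ZMod d) ℂ)
    (v : (Fin (m + 1) → ZMod d) → ℂ) : (Fin (m + 1) → ZMod d) → ℂ :=
  fun a => ∑ c : ZMod d, M (a (Fin.last m)) c * v (Function.update a (Fin.last m) c)

/-- The recursively constructed entangled-entanglement seed states:
`Φ₁ = |0⟩` and `Φ_{m+1} = (1/√d) ∑_i |i⟩ ⊗ (𝟙^{⊗(m−1)} ⊗ W_{i,i}) Φ_m`.
Here `EEPhi d m` is the state of `m+1` particles, i.e. `Φ_{m+1}`. -/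
noncomputable def EEPhi (d : ℕ) [NeZero d] : (m : ℕ) → (Fin (m + 1) → ZMod d) → ℂ
  | 0 => fun a => if a 0 = 0 then 1 else 0
  | m + 1 => fun a =>
      (Real.sqrt d : ℂ)⁻¹ *
        ∑ i : ZMod d, (if a 0 = i then 1 else 0) *
          applyLast d m (Weyl d i i) (EEPhi d m) (fun j => a j.succ)

/-- Application of the tensor-product operator `M 0 ⊗ M 1 ⊗ ⋯ ⊗ M (m−1)` in coordinates. -/
noncomputable def applyTensor (d m : ℕ) [NeZero d] (M : Fin m → Matrix (ZMod d) (ZMod d) ℂ)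
    (v : (Fin m → ZMod d) → ℂ) : (Fin m → ZMod d) → ℂ :=
  fun a => ∑ b : Fin m → ZMod d, (∏ p, M p (a p) (b p)) * v b

/-- The GHZ-type basis states
`Φ_n^d(s₁,…,s_{n−2},k,l) = (𝟙 ⊗ W_{s₁,0} ⊗ ⋯ ⊗ W_{s_{n−2},0} ⊗ W_{k,l}) Φ_n`
for `n = m + 2` particles of dimension `d`. -/
noncomputable def ghzState (d m : ℕ) [NeZero d] (s : Fin m → ZMod d) (k l : ZMod d) :
    (Fin (m + 2) → ZMod d) → ℂ :=
  applyTensor d (m + 2)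
    (fun p =>
      if h0 : (p : ℕ) = 0 then (1 : Matrix (ZMod d) (ZMod d) ℂ)
      else if h1 : (p : ℕ) = m + 1 then Weyl d k l
      else Weyl d (s ⟨(p : ℕ) - 1, by have := p.isLt; omega⟩) 0)
    (EEPhi d (m + 1))

lemma AddChar.map_sum_eq_prod_aux {A ι : Type*} [AddCommMonoid A] (ψ : AddChar A ℂ)
    (f : ι → A) (t : Finset ι) : ψ (∑ i ∈ t, f i) = ∏ i ∈ t, ψ (f i) := by
  classical
  induction t using Finset.induction_on with
  | empty => simp
  | insert a t ha ih => rw [Finset.sum_insert ha, Finset.prod_insert ha, AddChar.map_add_eq_mul, ih]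

lemma omega_pow_val (d : ℕ) [NeZero d] (x : ZMod d) :
    omega d ^ x.val = ZMod.stdAddChar x := by
  rw [ZMod.stdAddChar_apply, ZMod.toCircle_apply, omega, ← Complex.exp_nat_mul]
  congr 1
  ring

lemma weyl_apply (d : ℕ) [NeZero d] (k l i j : ZMod d) :
    Weyl d k l i j = if j = i + l then ZMod.stdAddChar (k * i) else 0 := by
  unfold Weyl
  rw [Matrix.of_apply, omega_pow_val]
  by_cases h : j = i + l
  · subst h; simp [mul_comm]
  · rw [if_neg h, if_neg]
    intro h'; apply h; rw [h']; ring

lemma eephi_form (d : ℕ) [NeZero d] (m : ℕ) :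
    ∀ a : Fin (m + 1) → ZMod d, star (EEPhi d m a) * EEPhi d m a
      = ((d : ℂ)⁻¹) ^ m * if ∑ p, a p = 0 then 1 else 0 := by
  induction m with
  | zero => intro a; simp [EEPhi]
  | succ m ih =>
    intro a
    have h1 : EEPhi d (m + 1) a = (Real.sqrt d : ℂ)⁻¹ *
        (ZMod.stdAddChar (a 0 * a (Fin.last _)) *
          EEPhi d m (Function.update (fun j => a j.succ) (Fin.last m) (a (Fin.last _) + a 0))) := by
      simp only [EEPhi, applyLast, weyl_apply]
      simp
    have h2 : ∑ p, Function.update (fun j => a (Fin.succ j)) (Fin.last m)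
        (a (Fin.last _) + a 0) p = ∑ p, a p := by
      rw [Fin.sum_univ_castSucc, Fin.sum_univ_succ a, Fin.sum_univ_castSucc (fun i => a (Fin.succ i))]
      simp [Function.update, Fin.castSucc_ne_last]
      ring
    have h3 := ih (Function.update (fun j => a j.succ) (Fin.last m) (a (Fin.last _) + a 0))
    rw [h2] at h3
    have h4 : star (ZMod.stdAddChar (a 0 * a (Fin.last _)) : ℂ)
        * ZMod.stdAddChar (a 0 * a (Fin.last _)) = 1 := by
      rw [ZMod.stdAddChar_apply, Complex.star_def, ← Complex.normSq_eq_conj_mul_self]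
      simp
    have h5 : star ((Real.sqrt d : ℂ)⁻¹) * (Real.sqrt d : ℂ)⁻¹ = (d : ℂ)⁻¹ := by
      rw [Complex.star_def, map_inv₀, Complex.conj_ofReal, ← mul_inv, ← Complex.ofReal_mul,
        Real.mul_self_sqrt (Nat.cast_nonneg d)]
      simp
    rw [h1, star_mul', star_mul', pow_succ, mul_right_comm (_ ^ m), ← h3, ← h5]
    linear_combination (star ((Real.sqrt d : ℂ)⁻¹) * (Real.sqrt d : ℂ)⁻¹ *
      (star (EEPhi d m (Function.update (fun j => a j.succ) (Fin.last m) (a (Fin.last _) + a 0))) *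
      EEPhi d m (Function.update (fun j => a j.succ) (Fin.last m) (a (Fin.last _) + a 0)))) * h4

lemma eephi_zero (d : ℕ) [NeZero d] (m : ℕ) (a : Fin (m + 1) → ZMod d) (h : ∑ p, a p ≠ 0) :
    EEPhi d m a = 0 := by
  have := eephi_form d m a
  rw [if_neg h, mul_zero] at this
  simpa using this

/-- phase exponents -/
def cvec (d m : ℕ) (s : Fin m → ZMod d) (k : ZMod d) : Fin (m + 2) → ZMod d :=
  Fin.cons 0 (Fin.snoc s k)

lemma ghz_apply (d m : ℕ) [NeZero d] (s : Fin m → ZMod d) (k l : ZMod d)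
    (a : Fin (m + 2) → ZMod d) :
    ghzState d m s k l a = ZMod.stdAddChar (∑ p, cvec d m s k p * a p) *
      EEPhi d (m + 1) (a + Pi.single (Fin.last _) l) := by
  unfold ghzState applyTensor
  have key : ∀ b : Fin (m + 2) → ZMod d, ∀ p : Fin (m + 2),
      (if h0 : (p : ℕ) = 0 then (1 : Matrix (ZMod d) (ZMod d) ℂ)
      else if h1 : (p : ℕ) = m + 1 then Weyl d k l
      else Weyl d (s ⟨(p : ℕ) - 1, by have := p.isLt; omega⟩) 0) (a p) (b p)
      = ZMod.stdAddChar (cvec d m s k p * a p) *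
        if b p = (a + Pi.single (Fin.last _) l : Fin (m + 2) → ZMod d) p then 1 else 0 := by
    intro b p
    refine Fin.cases ?_ (fun q => ?_) p
    · have : (0 : Fin (m + 2)) ≠ Fin.last (m + 1) := by simp [Fin.ext_iff]
      simp [cvec, Matrix.one_apply, Pi.single_eq_of_ne this, eq_comm]
    · refine Fin.lastCases ?_ (fun r => ?_) q
      · simp [cvec, weyl_apply]
      · have h : r.castSucc.succ ≠ Fin.last (m + 1) := by
          have := r.isLt
          simp [Fin.ext_iff]; omega
        have h2 : (r : ℕ) ≠ m := by have := r.isLt; omega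
        simp [cvec, weyl_apply, Pi.single_eq_of_ne h, h2]
  simp only [key, Finset.prod_mul_distrib]
  rw [Finset.sum_eq_single (a + Pi.single (Fin.last _) l)]
  · simp [AddChar.map_sum_eq_prod_aux]
  · intro b _ hb
    obtain ⟨p, hp⟩ := Function.ne_iff.mp hb
    rw [Finset.prod_eq_zero (i := p) (f := fun p => if b p = _ then (1:ℂ) else 0)
      (Finset.mem_univ _) (if_neg hp)]
    simp
  · simp

lemma char_sum (d n : ℕ) [NeZero d] (c : Fin n → ZMod d) :
    ∑ t : Fin n → ZMod d, (ZMod.stdAddChar (∑ p, c p * t p) : ℂ)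
      = if c = 0 then (d : ℂ) ^ n else 0 := by
  simp only [AddChar.map_sum_eq_prod_aux]
  have := Finset.prod_univ_sum (fun _ : Fin n => (Finset.univ : Finset (ZMod d)))
    (fun p x => (ZMod.stdAddChar (c p * x) : ℂ))
  rw [Fintype.piFinset_univ] at this
  rw [← this]
  have h : ∀ y : ZMod d, ∑ x : ZMod d, (ZMod.stdAddChar (y * x) : ℂ)
      = if y = 0 then (d : ℂ) else 0 := by
    intro y
    have := AddChar.sum_mulShift y (ZMod.isPrimitive_stdAddChar d)
    simp only [mul_comm _ y] at this
    rw [this]; simp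
  simp only [h]
  by_cases hc : c = 0
  · simp [hc]
  · rw [if_neg hc]
    obtain ⟨p, hp⟩ := Function.ne_iff.mp hc
    exact Finset.prod_eq_zero (Finset.mem_univ p) (if_neg hp)

lemma ghz_orth (d m : ℕ) [NeZero d] (s s' : Fin m → ZMod d) (k l k' l' : ZMod d) :
      star (ghzState d m s' k' l') ⬝ᵥ ghzState d m s k l
        = if s' = s ∧ k' = k ∧ l' = l then 1 else 0 := by
  have hs : ∀ (l : ZMod d) (a : Fin (m + 2) → ZMod d),
      ∑ p, (a + Pi.single (Fin.last _) l : Fin (m + 2) → ZMod d) p = ∑ p, a p + l := by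
    intro l a
    simp [Finset.sum_add_distrib]
  have hz : ∀ (l : ZMod d) (a : Fin (m + 2) → ZMod d), ∑ p, a p + l ≠ 0 →
      EEPhi d (m + 1) (a + Pi.single (Fin.last _) l) = 0 := by
    intro l a h
    apply eephi_zero
    rwa [hs]
  unfold dotProduct
  simp only [Pi.star_apply, ghz_apply]
  by_cases hl : l' = l
  swap
  · rw [if_neg (by tauto)]
    apply Finset.sum_eq_zero
    intro a _
    by_cases h : ∑ p, a p + l = 0
    · rw [hz l' a, mul_zero, star_zero, zero_mul]
      intro h'; apply hl
      linear_combination h' - h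
    · rw [hz l a h, mul_zero, mul_zero]
  subst hl
  have hstar : ∀ x : ZMod d, star (ZMod.stdAddChar x : ℂ) = ZMod.stdAddChar (-x) := by
    intro x
    rw [AddChar.map_neg_eq_conj]; rfl
  have h1 : ∀ a : Fin (m + 2) → ZMod d,
      star ((ZMod.stdAddChar (∑ p, cvec d m s' k' p * a p) : ℂ) *
        EEPhi d (m + 1) (a + Pi.single (Fin.last _) l')) *
      (ZMod.stdAddChar (∑ p, cvec d m s k p * a p) *
        EEPhi d (m + 1) (a + Pi.single (Fin.last _) l'))
      = ((d : ℂ)⁻¹) ^ (m + 1) * ((ZMod.stdAddChar (∑ p : Fin (m + 1),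
          ((Fin.snoc s k : Fin (m + 1) → ZMod d) - (Fin.snoc s' k' : Fin (m + 1) → ZMod d)) p
            * a p.succ) : ℂ) *
        if a 0 = - (∑ p : Fin (m + 1), a p.succ) - l' then 1 else 0) := by
    intro a
    have e := eephi_form d (m + 1) (a + Pi.single (Fin.last _) l')
    rw [hs] at e
    have e2 : (∑ p, a p + l' = 0) ↔ a 0 = - (∑ p : Fin (m + 1), a p.succ) - l' := by
      rw [Fin.sum_univ_succ]
      constructor
      · intro h; linear_combination h
      · intro h; linear_combination h
    simp only [e2] at e
    rw [star_mul', hstar, mul_mul_mul_comm, e, ← AddChar.map_add_eq_mul]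
    have e3 : -∑ p, cvec d m s' k' p * a p + ∑ p, cvec d m s k p * a p
      = ∑ p : Fin (m + 1),
          ((Fin.snoc s k : Fin (m + 1) → ZMod d) - (Fin.snoc s' k' : Fin (m + 1) → ZMod d)) p
            * a p.succ := by
      rw [Fin.sum_univ_succ, Fin.sum_univ_succ (fun p => cvec d m s k p * a p)]
      simp only [cvec, Fin.cons_zero, Fin.cons_succ, Pi.sub_apply, sub_mul,
        Finset.sum_sub_distrib]
      ring
    rw [e3]
    ring
  simp only [h1]
  rw [← Finset.mul_sum, ← (Fin.consEquiv (fun _ : Fin (m + 2) => ZMod d)).sum_comp,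
    Fintype.sum_prod_type_right]
  simp only [Fin.consEquiv_apply, Fin.cons_zero, Fin.cons_succ, mul_ite, mul_one, mul_zero,
    Finset.sum_ite_eq', Finset.sum_ite_eq, Finset.mem_univ, if_true]
  rw [char_sum]
  have hc : ((Fin.snoc s k : Fin (m + 1) → ZMod d) - (Fin.snoc s' k' : Fin (m + 1) → ZMod d)) = 0
      ↔ (s' = s ∧ k' = k ∧ l' = l') := by
    rw [sub_eq_zero]
    constructor
    · intro h
      refine ⟨?_, ?_, rfl⟩
      · funext j
        simpa using (congrFun h j.castSucc).symm
      · simpa using (congrFun h (Fin.last m)).symm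
    · rintro ⟨rfl, rfl, -⟩; rfl
  simp only [hc]
  split_ifs
  · rw [← mul_pow, inv_mul_cancel₀ (Nat.cast_ne_zero.mpr (NeZero.ne d)), one_pow]
  · simp

open Matrix in
/-- For every `d ≥ 2` and `n = m + 2 ≥ 2`, the `d^n` states `Φ_n^d(s₁,…,s_{n−2},k,l)`
form an orthonormal basis of `(ℂ^d)^{⊗n}`:
`⟨Φ_n^d(s',k',l'), Φ_n^d(s,k,l)⟩ = δ_{s's} δ_{k'k} δ_{l'l}`, and they span the space. -/
theorem ghzState_orthonormal_basis (d : ℕ) [NeZero d] (hd : 2 ≤ d) (m : ℕ) :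
    (∀ (s s' : Fin m → ZMod d) (k l k' l' : ZMod d),
      star (ghzState d m s' k' l') ⬝ᵥ ghzState d m s k l
        = if s' = s ∧ k' = k ∧ l' = l then 1 else 0) ∧
    Submodule.span ℂ {w | ∃ s k l, w = ghzState d m s k l} = ⊤ := by
  refine ⟨fun s s' k l k' l' => ghz_orth d m s s' k l k' l', ?_⟩
  let f : (Fin m → ZMod d) × ZMod d × ZMod d → ((Fin (m + 2) → ZMod d) → ℂ) :=
    fun x => ghzState d m x.1 x.2.1 x.2.2
  have hf : ∀ x y, star (f x) ⬝ᵥ f y = if x = y then 1 else 0 := by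
    rintro ⟨s', k', l'⟩ ⟨s, k, l⟩
    simp only [f, ghz_orth, Prod.mk.injEq]
  have hset : {w | ∃ s k l, w = ghzState d m s k l} = Set.range f := by
    ext w
    constructor
    · rintro ⟨s, k, l, rfl⟩; exact ⟨(s, k, l), rfl⟩
    · rintro ⟨⟨s, k, l⟩, rfl⟩; exact ⟨s, k, l, rfl⟩
  have hli : LinearIndependent ℂ f := by
    rw [Fintype.linearIndependent_iff]
    intro g hg x
    have := congrArg (fun v => star (f x) ⬝ᵥ v) hg
    simpa [dotProduct_sum, dotProduct_smul, hf] using this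
  rw [hset]
  apply hli.span_eq_top_of_card_eq_finrank'
  simp [ZMod.card, pow_succ, mul_assoc]
end

section
/- For d ≥ 2 and α ∈ ℝ with σ_noise = ((1−α)/d³) 𝟙 + α |GHZ_d⟩⟨GHZ_d| on ℂ^d⊗ℂ^d⊗ℂ^d, the partial transpose σ_noise^{PT₃} is positive semidefinite if and only if −1/(d²−1) ≤ α ≤ 1/(d²+1); its nonzero-type eigenvalues are (1−α)/d³, (1+(d²−1)α)/d³ and (1−(d²+1)α)/d³. In particular, for 1/(d²+1) < α ≤ 1 the state σ_noise has a negative partial transpose and is therefore entangled. -/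
open Matrix
open scoped ComplexOrder

/-- The generalized GHZ state `|GHZ_d⟩ = (1/√d) ∑ i, |i⟩⊗|i⟩⊗|i⟩` in `ℂ^d⊗ℂ^d⊗ℂ^d`. -/
noncomputable def ghzVec (d : ℕ) : Fin d × Fin d × Fin d → ℂ :=
  fun p => if p.2.1 = p.1 ∧ p.2.2 = p.1 then (Real.sqrt d : ℂ)⁻¹ else 0

/-- The isotropic GHZ state `σ_noise = ((1−α)/d³) 𝟙 + α |GHZ_d⟩⟨GHZ_d|`. -/
noncomputable def sigmaNoise (d : ℕ) (α : ℝ) :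
    Matrix (Fin d × Fin d × Fin d) (Fin d × Fin d × Fin d) ℂ :=
  (((1 - α) / (d : ℝ) ^ 3 : ℝ) : ℂ) • (1 : Matrix _ _ ℂ) +
    (α : ℂ) • vecMulVec (ghzVec d) (star (ghzVec d))

/-- Partial transpose with respect to the third tensor factor, determined by
`(A⊗B⊗C)^{PT₃} = A⊗B⊗Cᵀ`. -/
def pt3 {d : ℕ} (M : Matrix (Fin d × Fin d × Fin d) (Fin d × Fin d × Fin d) ℂ) :
    Matrix (Fin d × Fin d × Fin d) (Fin d × Fin d × Fin d) ℂ :=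
  Matrix.of fun p q => M (p.1, p.2.1, q.2.2) (q.1, q.2.1, p.2.2)

/-- A density matrix on `ℂ^d⊗ℂ^d⊗ℂ^d` is fully separable if it is a finite convex
combination of projectors onto product unit vectors. -/
def FullySeparable {d : ℕ}
    (ρ : Matrix (Fin d × Fin d × Fin d) (Fin d × Fin d × Fin d) ℂ) : Prop :=
  ∃ (k : ℕ) (p : Fin k → ℝ) (u v w : Fin k → (Fin d → ℂ)),
    (∀ i, 0 ≤ p i) ∧ (∑ i, p i = 1) ∧
    (∀ i, star (u i) ⬝ᵥ u i = 1) ∧ (∀ i, star (v i) ⬝ᵥ v i = 1) ∧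
    (∀ i, star (w i) ⬝ᵥ w i = 1) ∧
    ρ = ∑ i, (p i : ℂ) •
      vecMulVec (fun q => u i q.1 * v i q.2.1 * w i q.2.2)
        (star fun q => u i q.1 * v i q.2.1 * w i q.2.2)

theorem pt3_apply (d : ℕ) (hd : 2 ≤ d) (α : ℝ) (p q : Fin d × Fin d × Fin d) :
    pt3 (sigmaNoise d α) p q =
      (if p = q then (((1 - α) / (d : ℝ) ^ 3 : ℝ) : ℂ) else 0) +
      (if p.1 = p.2.1 then (if (p.2.2, p.2.2, p.1) = q then ((α / d : ℝ) : ℂ) else 0) else 0) := by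
  obtain ⟨p1, p2, p3⟩ := p
  obtain ⟨q1, q2, q3⟩ := q
  have hs : ((Real.sqrt d : ℝ) : ℂ)⁻¹ * ((Real.sqrt d : ℝ) : ℂ)⁻¹ = ((d : ℝ) : ℂ)⁻¹ := by
    rw [← mul_inv, ← Complex.ofReal_mul, Real.mul_self_sqrt (Nat.cast_nonneg d)]
  have h1 : ((1 : Matrix (Fin d × Fin d × Fin d) (Fin d × Fin d × Fin d) ℂ)
      (p1, p2, q3) (q1, q2, p3)) = if (p1, p2, p3) = (q1, q2, q3) then 1 else 0 := by
    rw [Matrix.one_apply]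
    congr 1
    simp only [Prod.mk.injEq, eq_iff_iff]
    tauto
  have h2 : vecMulVec (ghzVec d) (star (ghzVec d)) (p1, p2, q3) (q1, q2, p3) =
      if p1 = p2 then (if (p3, p3, p1) = (q1, q2, q3) then ((d : ℝ) : ℂ)⁻¹ else 0) else 0 := by
    rw [← hs]
    simp only [vecMulVec_apply, ghzVec, Pi.star_apply, Prod.mk.injEq]
    have : star ((Real.sqrt d : ℝ) : ℂ)⁻¹ = ((Real.sqrt d : ℝ) : ℂ)⁻¹ := by simp
    rw [apply_ite star, this, star_zero]
    split_ifs <;> first | (exfalso; grind) | simp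
  simp only [pt3, sigmaNoise, Matrix.of_apply, Matrix.add_apply, Matrix.smul_apply, h1, h2,
    smul_eq_mul]
  congr 1
  · split_ifs <;> simp
  · split_ifs <;> simp [div_eq_mul_inv]

theorem pt3_mulVec (d : ℕ) (hd : 2 ≤ d) (α : ℝ) (v : Fin d × Fin d × Fin d → ℂ)
    (p : Fin d × Fin d × Fin d) :
    (pt3 (sigmaNoise d α) *ᵥ v) p =
      (((1 - α) / (d : ℝ) ^ 3 : ℝ) : ℂ) * v p +
      (if p.1 = p.2.1 then ((α / d : ℝ) : ℂ) * v (p.2.2, p.2.2, p.1) else 0) := by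
  simp only [Matrix.mulVec, dotProduct, pt3_apply d hd, add_mul, Finset.sum_add_distrib]
  congr 1
  · simp
  · split_ifs <;> simp

theorem pt3_herm (d : ℕ) (hd : 2 ≤ d) (α : ℝ) : (pt3 (sigmaNoise d α)).IsHermitian := by
  ext p q
  obtain ⟨p1, p2, p3⟩ := p
  obtain ⟨q1, q2, q3⟩ := q
  simp only [Matrix.conjTranspose_apply, pt3_apply d hd, star_add, Prod.mk.injEq]
  congr 1
  · split_ifs <;> first | (exfalso; grind) | simp
  · split_ifs <;> first | (exfalso; grind) | simp

theorem pt3_mem_spectrum (d : ℕ) (hd : 2 ≤ d) (α : ℝ) (μ : ℂ) :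
    μ ∈ spectrum ℂ (pt3 (sigmaNoise d α)) ↔
      ∃ v : Fin d × Fin d × Fin d → ℂ, v ≠ 0 ∧ ∀ p,
        (((1 - α) / (d : ℝ) ^ 3 : ℝ) : ℂ) * v p +
      (if p.1 = p.2.1 then ((α / d : ℝ) : ℂ) * v (p.2.2, p.2.2, p.1) else 0) = μ * v p := by
  rw [← Matrix.spectrum_toLin', ← Module.End.hasEigenvalue_iff_mem_spectrum]
  constructor
  · intro h
    obtain ⟨v, hv⟩ := h.exists_hasEigenvector
    refine ⟨v, hv.2, fun p => ?_⟩
    have := congrFun hv.apply_eq_smul p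
    rw [Matrix.toLin'_apply, pt3_mulVec d hd] at this
    simpa using this
  · rintro ⟨v, hv, h⟩
    refine Module.End.hasEigenvalue_of_hasEigenvector (x := v) ⟨?_, hv⟩
    rw [Module.End.mem_eigenspace_iff]
    ext p
    rw [Matrix.toLin'_apply, pt3_mulVec d hd, h p]
    simp

theorem pt3_spectrum (d : ℕ) (hd : 2 ≤ d) (α : ℝ) :
    spectrum ℂ (pt3 (sigmaNoise d α)) =
      {(((1 - α) / (d : ℝ) ^ 3 : ℝ) : ℂ),
        (((1 + ((d : ℝ) ^ 2 - 1) * α) / (d : ℝ) ^ 3 : ℝ) : ℂ),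
        (((1 - ((d : ℝ) ^ 2 + 1) * α) / (d : ℝ) ^ 3 : ℝ) : ℂ)} := by
  have hd0 : (d : ℝ) ≠ 0 := by positivity
  have e1 : (1 + ((d : ℝ) ^ 2 - 1) * α) / (d : ℝ) ^ 3 = (1 - α) / (d : ℝ) ^ 3 + α / d := by
    field_simp; ring
  have e2 : (1 - ((d : ℝ) ^ 2 + 1) * α) / (d : ℝ) ^ 3 = (1 - α) / (d : ℝ) ^ 3 - α / d := by
    field_simp; ring
  rw [e1, e2, Complex.ofReal_add, Complex.ofReal_sub]
  ext μ
  rw [pt3_mem_spectrum d hd]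
  generalize (((1 - α) / (d : ℝ) ^ 3 : ℝ) : ℂ) = a
  generalize ((α / d : ℝ) : ℂ) = b
  simp only [Set.mem_insert_iff, Set.mem_singleton_iff]
  constructor
  · rintro ⟨v, hv, h⟩
    obtain ⟨⟨i, k, j⟩, hp⟩ := Function.ne_iff.mp hv
    simp only [Pi.zero_apply] at hp
    by_cases hik : i = k
    · subst hik
      have h1 := h (i, i, j)
      have h2 := h (j, j, i)
      simp only [if_true] at h1 h2
      have h3 : (μ - (a + b)) * (μ - (a - b)) * v (i, i, j) = 0 := by
        linear_combination (-(μ - a)) * h1 - b * h2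
      rcases mul_eq_zero.mp h3 with h3 | h3
      · rcases mul_eq_zero.mp h3 with h3 | h3
        · exact Or.inr (Or.inl (sub_eq_zero.mp h3))
        · exact Or.inr (Or.inr (sub_eq_zero.mp h3))
      · exact absurd h3 hp
    · have h1 := h (i, k, j)
      simp only [hik, if_false, add_zero] at h1
      exact Or.inl (mul_right_cancel₀ hp h1).symm
  · let x : Fin d := ⟨0, by omega⟩
    let y : Fin d := ⟨1, by omega⟩
    have hxy : x ≠ y := by simp [x, y]
    clear_value x y
    rintro (rfl | rfl | rfl)
    · refine ⟨Pi.single (x, y, x) 1, by simp, ?_⟩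
      rintro ⟨i, k, j⟩
      simp only [Pi.single_apply, Prod.mk.injEq]
      split_ifs <;> first | (exfalso; grind) | simp
    · refine ⟨Pi.single (x, x, x) 1, by simp, ?_⟩
      rintro ⟨i, k, j⟩
      simp only [Pi.single_apply, Prod.mk.injEq]
      split_ifs <;> first | (exfalso; grind) | (simp; done) | (simp; ring)
    · refine ⟨fun p => if p = (x, x, y) then 1 else if p = (y, y, x) then -1 else 0, ?_, ?_⟩
      · intro h
        simpa using congrFun h (x, x, y)
      rintro ⟨i, k, j⟩
      simp only [Prod.mk.injEq]
      split_ifs <;> first | (exfalso; grind) | (simp; done) | (simp; ring)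

theorem pt3_posSemidef_iff (d : ℕ) (hd : 2 ≤ d) (α : ℝ) :
    (pt3 (sigmaNoise d α)).PosSemidef ↔
      -(1 / ((d : ℝ) ^ 2 - 1)) ≤ α ∧ α ≤ 1 / ((d : ℝ) ^ 2 + 1) := by
  have hd2 : (2 : ℝ) ≤ d := by exact_mod_cast hd
  have hm : 0 < (d : ℝ) ^ 2 - 1 := by nlinarith
  have hp : 0 < (d : ℝ) ^ 2 + 1 := by positivity
  have hc : 0 < (d : ℝ) ^ 3 := by positivity
  have hdiv : ∀ x : ℝ, 0 ≤ x / (d : ℝ) ^ 3 ↔ 0 ≤ x := fun x => by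
    rw [le_div_iff₀ hc, zero_mul]
  rw [Matrix.posSemidef_iff_isHermitian_and_spectrum_nonneg, pt3_spectrum d hd]
  rw [and_iff_right (pt3_herm d hd α)]
  simp only [Set.insert_subset_iff, Set.singleton_subset_iff, Set.mem_ofPred_eq,
    Complex.zero_le_real, hdiv, ← neg_div]
  rw [div_le_iff₀ hm, le_div_iff₀ hp]
  constructor
  · rintro ⟨-, h1, h2⟩
    constructor <;> linarith
  · rintro ⟨h1, h2⟩
    refine ⟨?_, ?_, ?_⟩ <;> nlinarith

theorem pt3_sep {d : ℕ} (ρ : Matrix (Fin d × Fin d × Fin d) (Fin d × Fin d × Fin d) ℂ)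
    (h : FullySeparable ρ) : (pt3 ρ).PosSemidef := by
  obtain ⟨k, p, u, v, w, hp, -, -, -, -, rfl⟩ := h
  have : pt3 (∑ i, (p i : ℂ) •
      vecMulVec (fun q : Fin d × Fin d × Fin d => u i q.1 * v i q.2.1 * w i q.2.2)
        (star fun q => u i q.1 * v i q.2.1 * w i q.2.2)) =
      ∑ i, (p i : ℂ) •
      vecMulVec (fun q : Fin d × Fin d × Fin d => u i q.1 * v i q.2.1 * star (w i q.2.2))
        (star fun q => u i q.1 * v i q.2.1 * star (w i q.2.2)) := by
    ext a b
    simp only [pt3, Matrix.of_apply, Matrix.sum_apply, Matrix.smul_apply, vecMulVec_apply,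
      Pi.star_apply, star_mul', star_star, smul_eq_mul]
    refine Finset.sum_congr rfl fun i _ => ?_
    ring
  rw [this]
  refine Matrix.posSemidef_sum _ fun i _ => ?_
  exact (Matrix.posSemidef_vecMulVec_self_star _).smul (by simpa using hp i)

/-- The partial transpose of `σ_noise` is positive semidefinite iff
`−1/(d²−1) ≤ α ≤ 1/(d²+1)`; its eigenvalues are `(1−α)/d³`, `(1+(d²−1)α)/d³` and
`(1−(d²+1)α)/d³`. Consequently, for `1/(d²+1) < α ≤ 1` the state `σ_noise` has a negative
partial transpose and is therefore entangled (not fully separable). -/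
theorem sigmaNoise_partialTranspose (d : ℕ) (hd : 2 ≤ d) (α : ℝ) :
    ((pt3 (sigmaNoise d α)).PosSemidef ↔
      -(1 / ((d : ℝ) ^ 2 - 1)) ≤ α ∧ α ≤ 1 / ((d : ℝ) ^ 2 + 1)) ∧
    spectrum ℂ (pt3 (sigmaNoise d α)) =
      {(((1 - α) / (d : ℝ) ^ 3 : ℝ) : ℂ),
        (((1 + ((d : ℝ) ^ 2 - 1) * α) / (d : ℝ) ^ 3 : ℝ) : ℂ),
        (((1 - ((d : ℝ) ^ 2 + 1) * α) / (d : ℝ) ^ 3 : ℝ) : ℂ)} ∧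
    (1 / ((d : ℝ) ^ 2 + 1) < α → α ≤ 1 → ¬ FullySeparable (sigmaNoise d α)) := by
  refine ⟨pt3_posSemidef_iff d hd α, pt3_spectrum d hd α, fun h1 _ hs => ?_⟩
  exact absurd ((pt3_posSemidef_iff d hd α).mp (pt3_sep _ hs)).2 (not_le.mpr h1)
end

section
/- For d ≥ 2, if α > 3/(d²+3) (and σ_noise is a density matrix, i.e. α ≤ 1), then σ_noise = ((1−α)/d³) 𝟙 + α |GHZ_d⟩⟨GHZ_d| on ℂ^d⊗ℂ^d⊗ℂ^d is not biseparable, i.e. it is genuinely multipartite entangled. Equivalently, the criterion value Q_0(σ_noise) = 2( α/d − 3(1−α)/d³ ), obtained from the matrix elements ⟨000|σ_noise|(d−1)(d−1)(d−1)⟩ and the corresponding diagonal elements, is strictly positive exactly for α > 3/(d²+3). -/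
open Matrix
open scoped ComplexOrder

/-- A vector of `ℂ^d⊗ℂ^d⊗ℂ^d` that is a product across the bipartition `1|23`. -/
def IsProd1 {d : ℕ} (Ψ : Fin d × Fin d × Fin d → ℂ) : Prop :=
  ∃ (u : Fin d → ℂ) (w : Fin d × Fin d → ℂ), Ψ = fun p => u p.1 * w p.2

/-- A vector of `ℂ^d⊗ℂ^d⊗ℂ^d` that is a product across the bipartition `2|13`. -/
def IsProd2 {d : ℕ} (Ψ : Fin d × Fin d × Fin d → ℂ) : Prop :=
  ∃ (u : Fin d → ℂ) (w : Fin d × Fin d → ℂ), Ψ = fun p => u p.2.1 * w (p.1, p.2.2)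

/-- A vector of `ℂ^d⊗ℂ^d⊗ℂ^d` that is a product across the bipartition `12|3`. -/
def IsProd3 {d : ℕ} (Ψ : Fin d × Fin d × Fin d → ℂ) : Prop :=
  ∃ (u : Fin d → ℂ) (w : Fin d × Fin d → ℂ), Ψ = fun p => u p.2.2 * w (p.1, p.2.1)

/-- A density matrix on `ℂ^d⊗ℂ^d⊗ℂ^d` is biseparable if it is a finite convex combination of
projectors onto unit vectors each of which is a product vector with respect to one of the
three bipartitions `1|23`, `2|13`, `12|3`. -/
def Biseparable {d : ℕ}
    (ρ : Matrix (Fin d × Fin d × Fin d) (Fin d × Fin d × Fin d) ℂ) : Prop :=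
  ∃ (k : ℕ) (p : Fin k → ℝ) (Ψ : Fin k → (Fin d × Fin d × Fin d → ℂ)),
    (∀ i, 0 ≤ p i) ∧ (∑ i, p i = 1) ∧
    (∀ i, star (Ψ i) ⬝ᵥ Ψ i = 1) ∧
    (∀ i, IsProd1 (Ψ i) ∨ IsProd2 (Ψ i) ∨ IsProd3 (Ψ i)) ∧
    ρ = ∑ i, (p i : ℂ) • vecMulVec (Ψ i) (star (Ψ i))

theorem bisep_term_bound {d : ℕ} (Ψ : Fin d × Fin d × Fin d → ℂ) (a b : Fin d)
    (h : IsProd1 Ψ ∨ IsProd2 Ψ ∨ IsProd3 Ψ) :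
    (Ψ (a, a, a) * star (Ψ (b, b, b))).re ≤
      ((Ψ (a, b, b) * star (Ψ (a, b, b))).re + (Ψ (b, a, a) * star (Ψ (b, a, a))).re +
       (Ψ (b, a, b) * star (Ψ (b, a, b))).re + (Ψ (a, b, a) * star (Ψ (a, b, a))).re +
       (Ψ (b, b, a) * star (Ψ (b, b, a))).re + (Ψ (a, a, b) * star (Ψ (a, a, b))).re) / 2 := by
  have hsq : ∀ z : ℂ, (z * star z).re = ‖z‖ ^ 2 := by
    intro z
    rw [Complex.star_def, Complex.mul_conj, Complex.ofReal_re, Complex.normSq_eq_norm_sq]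
  have hle : (Ψ (a, a, a) * star (Ψ (b, b, b))).re ≤ ‖Ψ (a, a, a)‖ * ‖Ψ (b, b, b)‖ := by
    refine (Complex.re_le_norm _).trans ?_
    rw [norm_mul, norm_star]
  simp only [hsq]
  refine hle.trans ?_
  have key : ‖Ψ (a, a, a)‖ * ‖Ψ (b, b, b)‖ = ‖Ψ (a, b, b)‖ * ‖Ψ (b, a, a)‖ ∨
      ‖Ψ (a, a, a)‖ * ‖Ψ (b, b, b)‖ = ‖Ψ (b, a, b)‖ * ‖Ψ (a, b, a)‖ ∨
      ‖Ψ (a, a, a)‖ * ‖Ψ (b, b, b)‖ = ‖Ψ (b, b, a)‖ * ‖Ψ (a, a, b)‖ := by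
    rcases h with ⟨u, w, rfl⟩ | ⟨u, w, rfl⟩ | ⟨u, w, rfl⟩
    · left; simp only [norm_mul]; ring
    · right; left; simp only [norm_mul]; ring
    · right; right; simp only [norm_mul]; ring
  have h1 := two_mul_le_add_sq ‖Ψ (a, b, b)‖ ‖Ψ (b, a, a)‖
  have h2 := two_mul_le_add_sq ‖Ψ (b, a, b)‖ ‖Ψ (a, b, a)‖
  have h3 := two_mul_le_add_sq ‖Ψ (b, b, a)‖ ‖Ψ (a, a, b)‖
  have s1 := sq_nonneg ‖Ψ (a, b, b)‖
  have s2 := sq_nonneg ‖Ψ (b, a, a)‖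
  have s3 := sq_nonneg ‖Ψ (b, a, b)‖
  have s4 := sq_nonneg ‖Ψ (a, b, a)‖
  have s5 := sq_nonneg ‖Ψ (b, b, a)‖
  have s6 := sq_nonneg ‖Ψ (a, a, b)‖
  rcases key with k | k | k <;> rw [k] <;> linarith

theorem bisep_bound {d : ℕ} (ρ : Matrix (Fin d × Fin d × Fin d) (Fin d × Fin d × Fin d) ℂ)
    (h : Biseparable ρ) (a b : Fin d) :
    (ρ (a, a, a) (b, b, b)).re ≤
      ((ρ (a, b, b) (a, b, b)).re + (ρ (b, a, a) (b, a, a)).re +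
       (ρ (b, a, b) (b, a, b)).re + (ρ (a, b, a) (a, b, a)).re +
       (ρ (b, b, a) (b, b, a)).re + (ρ (a, a, b) (a, a, b)).re) / 2 := by
  obtain ⟨k, p, Ψ, hp, -, -, hprod, rfl⟩ := h
  have entry : ∀ x y, ((∑ i, (p i : ℂ) • vecMulVec (Ψ i) (star (Ψ i))) x y).re =
      ∑ i, p i * (Ψ i x * star (Ψ i y)).re := by
    intro x y
    rw [Matrix.sum_apply, Complex.re_sum]
    refine Finset.sum_congr rfl fun i _ => ?_
    rw [Matrix.smul_apply, vecMulVec_apply, smul_eq_mul, Complex.re_ofReal_mul, Pi.star_apply]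
  simp only [entry]
  simp only [← Finset.sum_add_distrib, Finset.sum_div]
  refine Finset.sum_le_sum fun i _ => ?_
  have := mul_le_mul_of_nonneg_left (bisep_term_bound (Ψ i) a b (hprod i)) (hp i)
  linarith

theorem sigmaNoise_off (d : ℕ) (α : ℝ) (a b : Fin d) (hab : a ≠ b) :
    (sigmaNoise d α (a, a, a) (b, b, b)).re = α / d := by
  have hs : ((Real.sqrt d : ℂ)⁻¹ * (Real.sqrt d : ℂ)⁻¹) = (((d : ℝ)⁻¹ : ℝ) : ℂ) := by
    rw [← mul_inv, ← Complex.ofReal_mul, Real.mul_self_sqrt (Nat.cast_nonneg d),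
      Complex.ofReal_inv]
  have hc : star ((Real.sqrt d : ℂ)⁻¹) = (Real.sqrt d : ℂ)⁻¹ := by
    rw [← Complex.ofReal_inv, Complex.star_def, Complex.conj_ofReal]
  have hne : ((a, a, a) : Fin d × Fin d × Fin d) ≠ (b, b, b) := by
    intro h; exact hab (congrArg Prod.fst h)
  have : sigmaNoise d α (a, a, a) (b, b, b) = ((α / d : ℝ) : ℂ) := by
    rw [sigmaNoise, Matrix.add_apply, Matrix.smul_apply, Matrix.smul_apply,
      Matrix.one_apply_ne hne, vecMulVec_apply, Pi.star_apply]
    simp only [ghzVec, and_self, if_true, hc, hs, smul_eq_mul, mul_zero, zero_add]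
    push_cast
    rw [div_eq_mul_inv]
  rw [this, Complex.ofReal_re]

theorem sigmaNoise_diag (d : ℕ) (α : ℝ) (a b c : Fin d) (h : ¬ (b = a ∧ c = a)) :
    (sigmaNoise d α (a, b, c) (a, b, c)).re = (1 - α) / (d : ℝ) ^ 3 := by
  have : sigmaNoise d α (a, b, c) (a, b, c) = (((1 - α) / (d : ℝ) ^ 3 : ℝ) : ℂ) := by
    rw [sigmaNoise, Matrix.add_apply, Matrix.smul_apply, Matrix.smul_apply,
      Matrix.one_apply_eq, vecMulVec_apply, Pi.star_apply]
    simp only [ghzVec, if_neg h, smul_eq_mul, zero_mul, mul_zero, add_zero, mul_one]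
  rw [this, Complex.ofReal_re]

/-- For `d ≥ 2`, if `3/(d²+3) < α ≤ 1` then `σ_noise` is not biseparable
(i.e. it is genuinely multipartite entangled); moreover the GHZ criterion value
`Q₀(σ_noise) = 2(α/d − 3(1−α)/d³)` is strictly positive exactly for `α > 3/(d²+3)`. -/
theorem sigmaNoise_genuine_multipartite_entanglement (d : ℕ) (hd : 2 ≤ d) (α : ℝ) :
    (3 / ((d : ℝ) ^ 2 + 3) < α → α ≤ 1 → ¬ Biseparable (sigmaNoise d α)) ∧
    (0 < 2 * (α / (d : ℝ) - 3 * (1 - α) / (d : ℝ) ^ 3) ↔ 3 / ((d : ℝ) ^ 2 + 3) < α) := by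
  have hd0 : (0 : ℝ) < d := by
    have : 0 < d := by omega
    exact_mod_cast this
  have hiff : (0 < 2 * (α / (d : ℝ) - 3 * (1 - α) / (d : ℝ) ^ 3) ↔
      3 / ((d : ℝ) ^ 2 + 3) < α) := by
    have e : 2 * (α / (d : ℝ) - 3 * (1 - α) / (d : ℝ) ^ 3) =
        2 * (α * ((d : ℝ) ^ 2 + 3) - 3) / (d : ℝ) ^ 3 := by
      field_simp
      ring
    rw [e, div_lt_iff₀ (by positivity), div_pos_iff_of_pos_right (by positivity)]
    constructor <;> intro h <;> linarith
  refine ⟨fun hα _ hb => ?_, hiff⟩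
  have hQ := hiff.2 hα
  let a : Fin d := ⟨0, by omega⟩
  let b : Fin d := ⟨1, by omega⟩
  have hab : a ≠ b := by simp [a, b]
  have hba : b ≠ a := hab.symm
  have := bisep_bound _ hb a b
  rw [sigmaNoise_off d α a b hab, sigmaNoise_diag d α a b b (by tauto),
    sigmaNoise_diag d α b a a (by tauto), sigmaNoise_diag d α b a b (by tauto),
    sigmaNoise_diag d α a b a (by tauto), sigmaNoise_diag d α b b a (by tauto),
    sigmaNoise_diag d α a a b (by tauto)] at this
  have e2 : 3 * (1 - α) / (d : ℝ) ^ 3 = 3 * ((1 - α) / (d : ℝ) ^ 3) := by ring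
  rw [e2] at hQ
  linarith
end
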